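/- Let τ ∈ ℂ with Im τ > 0 and θ(z) = θ₁(z,τ). Let w, X, Y, Y', Z, Z' ∈ ℂ be such that θ(X−Z), θ(Y'−Z'), θ(w−X+Y'−Y+Z'−Z) and θ(w−Y) are all nonzero. Define X₁ = [θ(X−Z')·θ(Y'−Z)·θ(w−X+Y'−Y)·θ(w−Y+Z'−Z)] / [θ(X−Z)·θ(Y'−Z')·θ(w−X+Y'−Y+Z'−Z)·θ(w−Y)] and Y₁ = [θ(Z−Z')·θ(X−Y')·θ(w−Z+Y'−Y)·θ(w−Y+Z'−X)] / [θ(X−Z)·θ(Y'−Z')·θ(w−X+Y'−Y+Z'−Z)·θ(w−Y)]. Then X₁ + Y₁ = 1. (This is the Fermat relation x₁^N + y₁^N = 1 for the first Fermat point of the theta-function parameterized R-matrix, in genus one.) -/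

import Mathlib

/-- The odd Jacobi theta function
`θ₁(z,τ) = -i ∑_{n ∈ ℤ} (-1)^n exp(iπτ(n+1/2)²) exp((2n+1)iπz)`. -/
noncomputable def theta1 (z τ : ℂ) : ℂ :=
  -Complex.I * ∑' n : ℤ,
    (-1 : ℂ) ^ n * Complex.exp ((Real.pi : ℂ) * Complex.I * τ * ((n : ℂ) + 1 / 2) ^ 2) *
      Complex.exp ((2 * (n : ℂ) + 1) * (Real.pi : ℂ) * Complex.I * z)

/-- The part of the series of `jacobiTheta₂ z (τ / 2)` over even indices. -/
noncomputable def evenTheta (z τ : ℂ) : ℂ := ∑' k : ℤ, jacobiTheta₂_term (2 * k) z (τ / 2)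

/-- The part of the series of `jacobiTheta₂ z (τ / 2)` over odd indices. -/
noncomputable def oddTheta (z τ : ℂ) : ℂ := ∑' k : ℤ, jacobiTheta₂_term (2 * k + 1) z (τ / 2)

/-- The summand in the series defining `theta1`. -/
noncomputable def theta1Term (z τ : ℂ) (n : ℤ) : ℂ :=
  (-1 : ℂ) ^ n * Complex.exp ((Real.pi : ℂ) * Complex.I * τ * ((n : ℂ) + 1 / 2) ^ 2) *
    Complex.exp ((2 * (n : ℂ) + 1) * (Real.pi : ℂ) * Complex.I * z)

theorem theta1_eq_tsum_theta1Term (z τ : ℂ) : theta1 z τ = -Complex.I * ∑' n, theta1Term z τ n :=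
  rfl

theorem theta1Term_eq_jacobiTheta₂_term (z τ : ℂ) (n : ℤ) :
    theta1Term z τ n = Complex.exp (Real.pi * Complex.I * (τ / 4 + z)) *
      ((-1 : ℂ) ^ n * jacobiTheta₂_term n (z + τ / 2) τ) := by
  rw [theta1Term, jacobiTheta₂_term, mul_left_comm, mul_assoc, ← Complex.exp_add, ← Complex.exp_add]
  ring_nf

theorem summable_norm_theta1Term (z : ℂ) {τ : ℂ} (hτ : 0 < τ.im) :
    Summable fun n ↦ ‖theta1Term z τ n‖ := by
  simp only [theta1Term_eq_jacobiTheta₂_term, norm_mul, norm_zpow, norm_neg, norm_one, one_zpow,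
    one_mul]
  exact ((summable_jacobiTheta₂_term_iff _ _).2 hτ).norm.mul_left _

theorem summable_norm_jacobiTheta₂_term_half_comp {f : ℤ → ℤ} (hf : Function.Injective f) (z : ℂ)
    {τ : ℂ} (hτ : 0 < τ.im) : Summable fun k ↦ ‖jacobiTheta₂_term (f k) z (τ / 2)‖ := by
  have h : 0 < (τ / 2).im := by
    rw [Complex.div_ofNat_im]
    positivity
  exact ((summable_jacobiTheta₂_term_iff z _).2 h).norm.comp_injective hf

/-- The parametrization of pairs `(n, m)` by `n + m + 1` and `n - m`, which have opposite parity: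
these are `2 k` and `2 l + 1` on the left summand, `2 k + 1` and `2 l` on the right one. -/
noncomputable def oppositeParityEquiv : (ℤ × ℤ) ⊕ (ℤ × ℤ) ≃ ℤ × ℤ :=
  Equiv.ofBijective
    (Sum.elim (fun p ↦ (p.1 + p.2, p.1 - p.2 - 1)) (fun p ↦ (p.1 + p.2, p.1 - p.2))) <| by
    constructor
    · rintro (⟨a, b⟩ | ⟨a, b⟩) (⟨c, d⟩ | ⟨c, d⟩) h <;>
        simp only [Sum.elim_inl, Sum.elim_inr, Prod.mk.injEq, Sum.inl.injEq, Sum.inr.injEq,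
          reduceCtorEq] at h ⊢ <;> omega
    · rintro ⟨n, m⟩
      rcases Int.even_or_odd' (n - m) with ⟨l, h | h⟩
      · exact ⟨.inr (m + l, l), by simp only [Sum.elim_inr, Prod.mk.injEq]; omega⟩
      · exact ⟨.inl (n - l, l), by simp only [Sum.elim_inl, Prod.mk.injEq]; omega⟩

theorem oppositeParityEquiv_inl (x : ℤ × ℤ) :
    oppositeParityEquiv (.inl x) = (x.1 + x.2, x.1 - x.2 - 1) := rfl

theorem oppositeParityEquiv_inr (x : ℤ × ℤ) :
    oppositeParityEquiv (.inr x) = (x.1 + x.2, x.1 - x.2) := rfl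

theorem theta1Term_mul_inl (x y τ : ℂ) (k l : ℤ) :
    theta1Term (x + y) τ (k + l) * theta1Term (x - y) τ (k - l - 1) =
      -(jacobiTheta₂_term (2 * k) x (τ / 2) * jacobiTheta₂_term (2 * l + 1) y (τ / 2)) := by
  have hs : (-1 : ℂ) ^ (k + l) * (-1 : ℂ) ^ (k - l - 1) = -1 := by
    rw [← zpow_add₀ (by norm_num)]
    exact Odd.neg_one_zpow ⟨k - 1, by ring⟩
  simp only [theta1Term, jacobiTheta₂_term]
  rw [mul_assoc ((-1 : ℂ) ^ (k + l)), mul_assoc ((-1 : ℂ) ^ (k - l - 1)), mul_mul_mul_comm, hs,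
    neg_one_mul]
  simp only [← Complex.exp_add]
  push_cast
  ring_nf

theorem theta1Term_mul_inr (x y τ : ℂ) (k l : ℤ) :
    theta1Term (x + y) τ (k + l) * theta1Term (x - y) τ (k - l) =
      jacobiTheta₂_term (2 * k + 1) x (τ / 2) * jacobiTheta₂_term (2 * l) y (τ / 2) := by
  have hs : (-1 : ℂ) ^ (k + l) * (-1 : ℂ) ^ (k - l) = 1 := by
    rw [← zpow_add₀ (by norm_num)]
    exact Even.neg_one_zpow ⟨k, by ring⟩
  simp only [theta1Term, jacobiTheta₂_term]
  rw [mul_assoc ((-1 : ℂ) ^ (k + l)), mul_assoc ((-1 : ℂ) ^ (k - l)), mul_mul_mul_comm, hs, one_mul]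
  simp only [← Complex.exp_add]
  push_cast
  ring_nf

theorem tsum_mul_tsum_eq_add_of_opposite_parity {f g p q r s : ℤ → ℂ}
    (hf : Summable fun n ↦ ‖f n‖) (hg : Summable fun n ↦ ‖g n‖)
    (hp : Summable fun n ↦ ‖p n‖) (hq : Summable fun n ↦ ‖q n‖)
    (hr : Summable fun n ↦ ‖r n‖) (hs : Summable fun n ↦ ‖s n‖)
    (hpq : ∀ k l, f (k + l) * g (k - l - 1) = -(p k * q l))
    (hrs : ∀ k l, f (k + l) * g (k - l) = r k * s l) :
    (∑' n, f n) * ∑' n, g n = -((∑' k, p k) * ∑' l, q l) + (∑' k, r k) * ∑' l, s l := by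
  rw [tsum_mul_tsum_of_summable_norm hf hg, tsum_mul_tsum_of_summable_norm hp hq,
    tsum_mul_tsum_of_summable_norm hr hs, ← oppositeParityEquiv.tsum_eq]
  have hl := (summable_mul_of_summable_norm hp hq).hasSum.neg
  have hr := (summable_mul_of_summable_norm hr hs).hasSum
  refine (HasSum.sum ?_ ?_).tsum_eq
  · convert! hl using 2 with x
    simp only [Function.comp_apply, oppositeParityEquiv_inl, hpq]
  · convert! hr using 2 with x
    simp only [Function.comp_apply, oppositeParityEquiv_inr, hrs]

/-- The addition formula for `theta1`, as a `2 × 2` determinant. -/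
theorem theta1_add_mul_theta1_sub (x y : ℂ) {τ : ℂ} (hτ : 0 < τ.im) :
    theta1 (x + y) τ * theta1 (x - y) τ =
      evenTheta x τ * oddTheta y τ - oddTheta x τ * evenTheta y τ := by
  have heven : Function.Injective fun k : ℤ ↦ 2 * k := mul_right_injective₀ two_ne_zero
  have hodd : Function.Injective fun k : ℤ ↦ 2 * k + 1 := (add_left_injective 1).comp heven
  have key := tsum_mul_tsum_eq_add_of_opposite_parity
    (summable_norm_theta1Term (x + y) hτ) (summable_norm_theta1Term (x - y) hτ)
    (summable_norm_jacobiTheta₂_term_half_comp heven x hτ)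
    (summable_norm_jacobiTheta₂_term_half_comp hodd y hτ)
    (summable_norm_jacobiTheta₂_term_half_comp hodd x hτ)
    (summable_norm_jacobiTheta₂_term_half_comp heven y hτ)
    (theta1Term_mul_inl x y τ) (theta1Term_mul_inr x y τ)
  rw [theta1_eq_tsum_theta1Term, theta1_eq_tsum_theta1Term, mul_mul_mul_comm, key, neg_mul_neg,
    Complex.I_mul_I, evenTheta, evenTheta, oddTheta, oddTheta]
  ring

/-- Genus-one Fermat relation `x₁^N + y₁^N = 1` for the first Fermat
point of the theta-function parameterized R-matrix: with `θ(z) = θ₁(z,τ)`, `Im τ > 0`,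
and the stated denominators nonzero,
`X₁ = θ(X-Z')θ(Y'-Z)θ(w-X+Y'-Y)θ(w-Y+Z'-Z) / (θ(X-Z)θ(Y'-Z')θ(w-X+Y'-Y+Z'-Z)θ(w-Y))`
and
`Y₁ = θ(Z-Z')θ(X-Y')θ(w-Z+Y'-Y)θ(w-Y+Z'-X) / (θ(X-Z)θ(Y'-Z')θ(w-X+Y'-Y+Z'-Z)θ(w-Y))`
satisfy `X₁ + Y₁ = 1`. -/
theorem theta1_fermat_relation_first (τ : ℂ) (hτ : 0 < τ.im)
    (w X Y Y' Z Z' : ℂ)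
    (h1 : theta1 (X - Z) τ ≠ 0) (h2 : theta1 (Y' - Z') τ ≠ 0)
    (h3 : theta1 (w - X + Y' - Y + Z' - Z) τ ≠ 0) (h4 : theta1 (w - Y) τ ≠ 0) :
    (theta1 (X - Z') τ * theta1 (Y' - Z) τ * theta1 (w - X + Y' - Y) τ *
        theta1 (w - Y + Z' - Z) τ) /
      (theta1 (X - Z) τ * theta1 (Y' - Z') τ * theta1 (w - X + Y' - Y + Z' - Z) τ *
        theta1 (w - Y) τ) +
    (theta1 (Z - Z') τ * theta1 (X - Y') τ * theta1 (w - Z + Y' - Y) τ *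
        theta1 (w - Y + Z' - X) τ) /
      (theta1 (X - Z) τ * theta1 (Y' - Z') τ * theta1 (w - X + Y' - Y + Z' - Z) τ *
        theta1 (w - Y) τ) = 1 := by
  rw [← add_div, div_eq_one_iff_eq (by simp [*])]
  set a := w - Y + (Y' + Z' - X - Z) / 2 with ha
  set b := (X + Z - Y' - Z') / 2 with hb
  set c := (X - Z + Y' - Z') / 2 with hc
  set d := (X - Z - Y' + Z') / 2 with hd
  have hab := theta1_add_mul_theta1_sub a b hτ
  have hcd := theta1_add_mul_theta1_sub c d hτ
  have hac := theta1_add_mul_theta1_sub a c hτ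
  have hbd := theta1_add_mul_theta1_sub b d hτ
  have had := theta1_add_mul_theta1_sub a d hτ
  have hcb := theta1_add_mul_theta1_sub c b hτ
  rw [show a + b = w - Y by grind, show a - b = w - X + Y' - Y + Z' - Z by grind] at hab
  rw [show c + d = X - Z by grind, show c - d = Y' - Z' by grind] at hcd
  rw [show a + c = w - Z + Y' - Y by grind, show a - c = w - Y + Z' - X by grind] at hac
  rw [show b + d = X - Y' by grind, show b - d = Z - Z' by grind] at hbd
  rw [show a + d = w - Y + Z' - Z by grind, show a - d = w - X + Y' - Y by grind] at had
  rw [show c + b = X - Z' by grind, show c - b = Y' - Z by grind] at hcb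
  grind
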